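/- arXiv:1109.2112 — 2 statements merged into one kernel-verified Lean document; each statement's English description precedes it below -/
import Mathlib

section
/- For a simple graph G (every multiplicity 1), γ'_l(G) ≤ max over edges uv of ⌈(d(u)+d(v)+t(uv)-1)/2⌉ where t(uv) ≤ 3; in particular for triangle-free simple graphs, χ'(G) ≤ max over edges uv of max{d(u), d(v)} + ⌈(min{d(u),d(v)} − 1)/2⌉... more simply: for a simple graph G, χ'(G) ≤ max over edges uv of ⌈max{d(u)+(d(v)-1)/2, d(v)+(d(u)-1)/2, (d(u)+d(v)+t(uv)-1)/2}⌉. -/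
open scoped Classical

/-- `t(uv)` for a simple graph: `3` if `u` and `v` have a common neighbour, else `1`. -/
noncomputable def simpleT {V : Type} (G : SimpleGraph V) (u v : V) : ℕ :=
  if ∃ w : V, G.Adj u w ∧ G.Adj v w then 3 else 1

namespace SimpleGraph

variable {V : Type} {K : ℕ}

/-- A connected component of a graph of maximum degree at most two has at most two ends. -/
theorem not_reachable_of_three_ends [Fintype V] (H : SimpleGraph V)
    (hdeg : ∀ x, H.degree x ≤ 2) {u v w : V} (huv : u ≠ v) (huw : u ≠ w) (hvw : v ≠ w)
    (hu : H.degree u ≤ 1) (hv : H.degree v ≤ 1) (hw : H.degree w ≤ 1)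
    (ruv : H.Reachable u v) : ¬ H.Reachable u w := by
  intro ruw
  let C := H.connectedComponentMk u
  let H' := C.toSimpleGraph
  have hdeg' : ∀ x : C, H'.degree x ≤ H.degree x := by
    intro x
    rw [← card_neighborFinset_eq_degree, ← card_neighborFinset_eq_degree]
    refine Finset.card_le_card_of_injOn Subtype.val ?_ Subtype.val_injective.injOn
    intro y hy
    have hxy : H'.Adj x y := by simpa using hy
    have : H.Adj x y := hxy
    simpa using this
  have mem : ∀ {x}, H.Reachable u x → x ∈ C := fun h => ConnectedComponent.sound h.symm
  let u' : C := ⟨u, mem (Reachable.refl u)⟩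
  let v' : C := ⟨v, mem ruv⟩
  let w' : C := ⟨w, mem ruw⟩
  have hends : ({u', v', w'} : Finset C).card = 3 :=
    Finset.card_eq_three.2 ⟨u', v', w', by simpa [u', v'] using huv, by simpa [u', w'] using huw,
      by simpa [v', w'] using hvw, rfl⟩
  have hedges := C.connected_toSimpleGraph.card_vert_le_card_edgeSet_add_one
  rw [Nat.card_eq_fintype_card, Nat.card_eq_fintype_card, ← edgeFinset_card] at hedges
  have hsum : ∑ x : C, (H'.degree x + if x ∈ ({u', v', w'} : Finset C) then 1 else 0) ≤
      ∑ _x : C, 2 := by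
    refine Finset.sum_le_sum fun x _ => ?_
    have h1 := hdeg' x
    have h2 := hdeg x
    split_ifs with hx
    · simp only [Finset.mem_insert, Finset.mem_singleton] at hx
      rcases hx with rfl | rfl | rfl
      · have : H'.degree u' ≤ H.degree u := h1
        omega
      · have : H'.degree v' ≤ H.degree v := h1
        omega
      · have : H'.degree w' ≤ H.degree w := h1
        omega
    · omega
  rw [Finset.sum_add_distrib, H'.sum_degrees_eq_twice_card_edges, Finset.sum_ite_mem,
    Finset.univ_inter, Finset.sum_const, hends, Finset.sum_const, Finset.card_univ] at hsum
  simp only [smul_eq_mul] at hsum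
  change _ ≤ H'.edgeFinset.card + 1 at hedges
  omega

/-- `c` is a proper colouring of some of the edges of `G`; the other pairs get `none`. -/
structure IsPartialEdgeColoring (G : SimpleGraph V) (c : Sym2 V → Option (Fin K)) : Prop where
  adj : ∀ {x y a}, c s(x, y) = some a → G.Adj x y
  proper : ∀ {x y z a}, c s(x, y) = some a → c s(x, z) = some a → y = z

/-- The colour `a` is missing at the vertex `x`. -/
def MissingAt (c : Sym2 V → Option (Fin K)) (x : V) (a : Fin K) : Prop :=
  ∀ y, c s(x, y) ≠ some a

/-- The number of coloured edges. -/
noncomputable def numColored [Fintype V] (c : Sym2 V → Option (Fin K)) : ℕ :=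
  (Finset.univ.filter fun e => c e ≠ none).card

/-- The subgraph of edges coloured `a` or `b`. -/
def kempeGraph (c : Sym2 V → Option (Fin K)) (a b : Fin K) : SimpleGraph V where
  Adj x y := x ≠ y ∧ (c s(x, y) = some a ∨ c s(x, y) = some b)
  symm := ⟨fun x y h => by rwa [ne_comm, Sym2.eq_swap]⟩
  loopless := ⟨fun x h => h.1 rfl⟩

namespace IsPartialEdgeColoring

variable {G : SimpleGraph V} {c : Sym2 V → Option (Fin K)}

theorem update (h : G.IsPartialEdgeColoring c) {u v : V} {a : Fin K} (huv : G.Adj u v)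
    (hu : MissingAt c u a) (hv : MissingAt c v a) :
    G.IsPartialEdgeColoring (Function.update c s(u, v) (some a)) := by
  have hne := huv.ne
  constructor
  · intro x y b hb
    rw [Function.update_apply] at hb
    split_ifs at hb with he
    · have : s(x, y) ∈ G.edgeSet := he ▸ huv
      exact this
    · exact h.adj hb
  · intro x y z b hy hz
    rw [Function.update_apply] at hy hz
    have key : ∀ y z, s(x, y) = s(u, v) → c s(x, z) ≠ some a := by
      intro y z he
      rcases Sym2.eq_iff.1 he with ⟨rfl, -⟩ | ⟨rfl, -⟩
      exacts [hu z, hv z]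
    split_ifs at hy hz with h1 h2 h2
    · exact Sym2.congr_right.1 (h1.trans h2.symm)
    · exact absurd (hz.trans hy.symm) (key y z h1)
    · exact absurd (hy.trans hz.symm) (key z y h2)
    · exact h.proper hy hz

theorem erase (h : G.IsPartialEdgeColoring c) (e : Sym2 V) :
    G.IsPartialEdgeColoring (Function.update c e none) := by
  have key : ∀ {e' a}, Function.update c e none e' = some a → c e' = some a := by
    intro e' a he
    rw [Function.update_apply] at he
    split_ifs at he
    exact he
  exact ⟨fun hb => h.adj (key hb), fun hy hz => h.proper (key hy) (key hz)⟩

/-- Swapping two colours on the Kempe component of `v`. -/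
theorem exists_kempe_swap [Fintype V] (h : G.IsPartialEdgeColoring c) (v : V) (a b : Fin K) :
    ∃ c' : Sym2 V → Option (Fin K), G.IsPartialEdgeColoring c' ∧ numColored c' = numColored c ∧
      (∀ x y, (kempeGraph c a b).Reachable v x →
        c' s(x, y) = (c s(x, y)).map (Equiv.swap a b)) ∧
      ∀ x y, ¬ (kempeGraph c a b).Reachable v x → c' s(x, y) = c s(x, y) := by
  let H := kempeGraph c a b
  let c' : Sym2 V → Option (Fin K) := fun e =>
    if ∃ x ∈ e, H.Reachable v x then (c e).map (Equiv.swap a b) else c e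
  have hin : ∀ x y, H.Reachable v x → c' s(x, y) = (c s(x, y)).map (Equiv.swap a b) :=
    fun x y hx => if_pos ⟨x, Sym2.mem_mk_left x y, hx⟩
  have hout : ∀ x y, ¬ H.Reachable v x → c' s(x, y) = c s(x, y) := by
    intro x y hx
    by_cases hy : H.Reachable v y
    · rw [Sym2.eq_swap, hin y x hy]
      rcases hc : c s(y, x) with _ | d
      · rfl
      · have hadj := (h.adj hc).ne
        have hnot : ¬ H.Adj y x := fun hyx => hx (hy.trans hyx.reachable)
        have hda : d ≠ a := fun hd => hnot ⟨hadj, Or.inl (hd ▸ hc)⟩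
        have hdb : d ≠ b := fun hd => hnot ⟨hadj, Or.inr (hd ▸ hc)⟩
        simp [Equiv.swap_apply_of_ne_of_ne hda hdb]
    · refine if_neg ?_
      rintro ⟨z, hz, hvz⟩
      rcases Sym2.mem_iff.1 hz with rfl | rfl
      exacts [hx hvz, hy hvz]
  have hnone : ∀ e, c' e = none ↔ c e = none := by
    intro e
    by_cases he : ∃ x ∈ e, H.Reachable v x <;> simp [c', he]
  refine ⟨c', ⟨?_, ?_⟩, ?_, hin, hout⟩
  · intro x y d hd
    rcases hc : c s(x, y) with _ | d'
    · simp [(hnone _).2 hc] at hd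
    · exact h.adj hc
  · intro x y z d hy hz
    by_cases hx : H.Reachable v x
    · rw [hin x _ hx, Option.map_eq_some_iff] at hy hz
      obtain ⟨d1, h1, e1⟩ := hy
      obtain ⟨d2, h2, e2⟩ := hz
      obtain rfl := (Equiv.swap a b).injective (e1.trans e2.symm)
      exact h.proper h1 h2
    · rw [hout x _ hx] at hy hz
      exact h.proper hy hz
  · unfold numColored
    simp only [ne_eq, hnone]

theorem degree_kempeGraph_le_two [Fintype V] (h : G.IsPartialEdgeColoring c) (a b : Fin K)
    (x : V) : (kempeGraph c a b).degree x ≤ 2 := by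
  have hinj : Set.InjOn (fun y => c s(x, y)) ((kempeGraph c a b).neighborFinset x) := by
    intro y hy z hz hyz
    simp only [Finset.mem_coe, mem_neighborFinset] at hy
    rcases hy.2 with hy | hy
    exacts [h.proper hy (hyz.symm.trans hy), h.proper hy (hyz.symm.trans hy)]
  rw [← card_neighborFinset_eq_degree, ← Finset.card_image_of_injOn hinj]
  refine (Finset.card_le_card (t := {some a, some b}) ?_).trans Finset.card_le_two
  intro o ho
  obtain ⟨y, hy, rfl⟩ := Finset.mem_image.1 ho
  rw [mem_neighborFinset] at hy
  simpa using hy.2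

theorem degree_kempeGraph_le_one [Fintype V] (h : G.IsPartialEdgeColoring c) {a b : Fin K}
    {x : V} (hx : MissingAt c x a ∨ MissingAt c x b) : (kempeGraph c a b).degree x ≤ 1 := by
  rw [← card_neighborFinset_eq_degree, Finset.card_le_one]
  intro y hy z hz
  rw [mem_neighborFinset] at hy hz
  rcases hx with hx | hx
  · exact h.proper (hy.2.resolve_left (hx y)) (hz.2.resolve_left (hx z))
  · exact h.proper (hy.2.resolve_right (hx y)) (hz.2.resolve_right (hx z))

theorem numColored_update [Fintype V] {e : Sym2 V} {a : Fin K} (he : c e = none) :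
    numColored (Function.update c e (some a)) = numColored c + 1 := by
  unfold numColored
  rw [← Finset.card_insert_of_notMem (a := e) (by simp [he])]
  congr 1
  ext e'
  by_cases h : e' = e <;> simp [Function.update_apply, h]

theorem numColored_erase [Fintype V] {e : Sym2 V} (he : c e ≠ none) :
    numColored (Function.update c e none) + 1 = numColored c := by
  obtain ⟨a, ha⟩ := Option.ne_none_iff_exists'.1 he
  rw [← numColored_update (a := a) (Function.update_self e none c), Function.update_idem, ← ha,
    Function.update_eq_self]

variable [Fintype V]

theorem not_missingAt_of_maximal (h : G.IsPartialEdgeColoring c)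
    (hmax : ∀ c' : Sym2 V → Option (Fin K), G.IsPartialEdgeColoring c' →
      numColored c' ≤ numColored c)
    {u v : V} (huv : G.Adj u v) (hc : c s(u, v) = none) {a : Fin K} (hu : MissingAt c u a) :
    ¬ MissingAt c v a := by
  intro hv
  have := hmax _ (h.update huv hu hv)
  rw [numColored_update hc] at this
  omega

theorem reachable_of_maximal (h : G.IsPartialEdgeColoring c)
    (hmax : ∀ c' : Sym2 V → Option (Fin K), G.IsPartialEdgeColoring c' →
      numColored c' ≤ numColored c)
    {u v : V} (huv : G.Adj u v) (hc : c s(u, v) = none) {a b : Fin K} (hu : MissingAt c u a)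
    (hv : MissingAt c v b) : (kempeGraph c a b).Reachable u v := by
  by_contra hr
  obtain ⟨c', h', hnum, hin, hout⟩ := h.exists_kempe_swap v a b
  have hr' : ¬ (kempeGraph c a b).Reachable v u := fun hvu => hr hvu.symm
  refine h'.not_missingAt_of_maximal (a := a) (fun c'' hc'' => hnum ▸ hmax c'' hc'') huv
    ((hout u v hr').trans hc) ?_ ?_
  · intro y
    rw [hout u y hr']
    exact hu y
  · intro y hy
    rw [hin v y (Reachable.refl v), Option.map_eq_some_iff] at hy
    obtain ⟨d, hd, hda⟩ := hy
    rw [Equiv.swap_apply_eq_iff, Equiv.swap_apply_left] at hda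
    exact hv y (hda ▸ hd)

theorem le_card_missingAt_add_card (c : Sym2 V → Option (Fin K)) (x : V) (s : Finset V)
    (hs : ∀ y, c s(x, y) ≠ none → y ∈ s) :
    K ≤ (Finset.univ.filter (MissingAt c x)).card + s.card := by
  have hsub : (Finset.univ.filter fun a => ¬ MissingAt c x a).image some ⊆
      s.image fun y => c s(x, y) := by
    intro o ho
    obtain ⟨a, ha, rfl⟩ := Finset.mem_image.1 ho
    simp only [Finset.mem_filter, Finset.mem_univ, true_and, MissingAt, not_forall,
      not_not] at ha
    obtain ⟨y, hy⟩ := ha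
    exact Finset.mem_image.2 ⟨y, hs y (by simp [hy]), hy⟩
  have h1 := (Finset.card_le_card hsub).trans Finset.card_image_le
  rw [Finset.card_image_of_injective _ (Option.some_injective _)] at h1
  have h2 := Finset.card_filter_add_card_filter_not (s := (Finset.univ : Finset (Fin K)))
    (MissingAt c x)
  rw [Finset.card_univ, Fintype.card_fin] at h2
  omega

theorem le_card_missingAt_add_degree (h : G.IsPartialEdgeColoring c) (x : V) :
    K ≤ (Finset.univ.filter (MissingAt c x)).card + G.degree x := by
  rw [← card_neighborFinset_eq_degree]
  refine le_card_missingAt_add_card c x _ fun y hy => ?_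
  obtain ⟨a, ha⟩ := Option.ne_none_iff_exists'.1 hy
  exact (mem_neighborFinset _ _ _).2 (h.adj ha)

theorem lt_card_missingAt_add_degree (h : G.IsPartialEdgeColoring c) {x y : V}
    (hxy : G.Adj x y) (hc : c s(x, y) = none) :
    K < (Finset.univ.filter (MissingAt c x)).card + G.degree x := by
  have hy : y ∈ G.neighborFinset x := (mem_neighborFinset _ _ _).2 hxy
  have := le_card_missingAt_add_card c x ((G.neighborFinset x).erase y) fun z hz => by
    obtain ⟨a, ha⟩ := Option.ne_none_iff_exists'.1 hz
    refine Finset.mem_erase.2 ⟨?_, (mem_neighborFinset _ _ _).2 (h.adj ha)⟩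
    rintro rfl
    exact hz hc
  rw [Finset.card_erase_of_mem hy, card_neighborFinset_eq_degree] at this
  have : 0 < G.degree x := (G.degree_pos_iff_exists_adj x).2 ⟨y, hxy⟩
  omega

/-- If `d(x) + ⌊d(y) / 2⌋` colours are available for every edge `xy`, then a partial edge
colouring with the most coloured edges colours every edge. -/
theorem ne_none_of_maximal (h : G.IsPartialEdgeColoring c)
    (hmax : ∀ c' : Sym2 V → Option (Fin K), G.IsPartialEdgeColoring c' →
      numColored c' ≤ numColored c)
    (hK : ∀ x y, G.Adj x y → G.degree x + G.degree y / 2 ≤ K) {u v : V} (huv : G.Adj u v) :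
    c s(u, v) ≠ none := by
  intro hc
  have hcu := h.lt_card_missingAt_add_degree huv hc
  have hcv := h.lt_card_missingAt_add_degree huv.symm (Sym2.eq_swap ▸ hc)
  have hKuv := hK u v huv
  have hKvu := hK v u huv.symm
  obtain ⟨a, ha⟩ := Finset.card_pos.1
    (show 0 < (Finset.univ.filter (MissingAt c u)).card by omega)
  obtain ⟨b, hb⟩ := Finset.card_pos.1
    (show 0 < (Finset.univ.filter (MissingAt c v)).card by omega)
  replace ha := (Finset.mem_filter.1 ha).2
  replace hb := (Finset.mem_filter.1 hb).2
  have hbu : ¬ MissingAt c u b := fun hbu => h.not_missingAt_of_maximal hmax huv hc hbu hb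
  simp only [MissingAt, not_forall, not_not] at hbu
  obtain ⟨w, hw⟩ := hbu
  have huw := h.adj hw
  have hwv : w ≠ v := by
    rintro rfl
    simp [hc] at hw
  have hvw : s(u, v) ≠ s(u, w) := fun he => hwv (Sym2.congr_right.1 he).symm
  -- Move the colour of `uw` to `uv`.
  let c₁ := Function.update c s(u, w) none
  have h₁ : G.IsPartialEdgeColoring c₁ := h.erase _
  have hc₁ : c₁ s(u, v) = none := by
    simp only [c₁, Function.update_of_ne hvw, hc]
  have hmiss₁ : ∀ x d, MissingAt c x d → MissingAt c₁ x d := by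
    intro x d hx y hy
    simp only [c₁, Function.update_apply] at hy
    split_ifs at hy
    exact hx y hy
  let c₂ := Function.update c₁ s(u, v) (some b)
  have h₂ : G.IsPartialEdgeColoring c₂ := by
    refine h₁.update huv ?_ (hmiss₁ v b hb)
    intro y hy
    simp only [c₁, Function.update_apply] at hy
    split_ifs at hy with he
    exact he (by rw [h.proper hy hw])
  have hnum : numColored c₂ = numColored c := by
    rw [numColored_update hc₁, numColored_erase (by simp [hw])]
  have hmax₂ : ∀ c' : Sym2 V → Option (Fin K), G.IsPartialEdgeColoring c' →
      numColored c' ≤ numColored c₂ := fun c' hc' => hnum ▸ hmax c' hc'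
  have hc₂ : c₂ s(u, w) = none := by
    simp only [c₂, c₁, Function.update_of_ne hvw.symm, Function.update_self]
  have hiff : ∀ d, d ≠ b → ∀ e, c₂ e = some d ↔ c e = some d := by
    intro d hd e
    by_cases h1 : e = s(u, v)
    · subst h1
      simp [c₂, hc, hd.symm]
    · by_cases h2 : e = s(u, w)
      · subst h2
        simp [hc₂, hw, hd.symm]
      · simp [c₂, c₁, h1, h2]
  have hmiss₂ : ∀ d, d ≠ b → ∀ x, MissingAt c x d → MissingAt c₂ x d :=
    fun d hd x hx y hy => hx y ((hiff d hd _).1 hy)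
  have hneb : ∀ d, MissingAt c u d → d ≠ b := fun d hd hdb => hd w (hdb ▸ hw)
  have hneb' : ∀ d, MissingAt c w d → d ≠ b :=
    fun d hd hdb => hd u (hdb ▸ Sym2.eq_swap ▸ hw)
  have duv : Disjoint (Finset.univ.filter (MissingAt c u))
      (Finset.univ.filter (MissingAt c v)) :=
    Finset.disjoint_filter.2 fun d _ hd => h.not_missingAt_of_maximal hmax huv hc hd
  have duw : Disjoint (Finset.univ.filter (MissingAt c u))
      (Finset.univ.filter (MissingAt c w)) :=
    Finset.disjoint_filter.2 fun d _ hd hd' =>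
      h₂.not_missingAt_of_maximal hmax₂ huw hc₂ (hmiss₂ d (hneb d hd) u hd)
        (hmiss₂ d (hneb d hd) w hd')
  have dvw : Disjoint (Finset.univ.filter (MissingAt c v))
      (Finset.univ.filter (MissingAt c w)) := by
    refine Finset.disjoint_filter.2 fun d _ hd hd' => ?_
    have hdb := hneb' d hd'
    have hab := hneb a ha
    have hgraph : kempeGraph c₂ a d = kempeGraph c a d := by
      ext x y
      simp only [kempeGraph, hiff a hab, hiff d hdb]
    have ruv := h.reachable_of_maximal hmax huv hc ha hd
    have ruw := h₂.reachable_of_maximal hmax₂ huw hc₂ (hmiss₂ a hab u ha) (hmiss₂ d hdb w hd')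
    rw [hgraph] at ruw
    exact not_reachable_of_three_ends _ (h.degree_kempeGraph_le_two a d) huv.ne huw.ne hwv.symm
      (h.degree_kempeGraph_le_one (Or.inl ha)) (h.degree_kempeGraph_le_one (Or.inr hd))
      (h.degree_kempeGraph_le_one (Or.inr hd')) ruv ruw
  have hcard := Finset.card_le_univ ((Finset.univ.filter (MissingAt c u) ∪
    Finset.univ.filter (MissingAt c v)) ∪ Finset.univ.filter (MissingAt c w))
  rw [Finset.card_union_of_disjoint (Finset.disjoint_union_left.2 ⟨duw, dvw⟩),
    Finset.card_union_of_disjoint duv, Fintype.card_fin] at hcard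
  have hcw := h.le_card_missingAt_add_degree w
  have hKwu := hK w u huw.symm
  omega

end IsPartialEdgeColoring

/-- A proper edge colouring exists as soon as `d(x) + ⌊d(y) / 2⌋` colours are available for every
edge `xy`. -/
theorem exists_edgeColoring_of_degree_add_half_le [Fintype V] (G : SimpleGraph V)
    (hK : ∀ x y, G.Adj x y → G.degree x + G.degree y / 2 ≤ K) :
    ∃ c : G.edgeSet → Fin K, ∀ e f : G.edgeSet, e ≠ f →
      (∃ x : V, x ∈ (e : Sym2 V) ∧ x ∈ (f : Sym2 V)) → c e ≠ c f := by
  obtain ⟨c, hc, hmax⟩ := Finset.exists_max_image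
    (Finset.univ.filter fun c : Sym2 V → Option (Fin K) => G.IsPartialEdgeColoring c) numColored
    ⟨fun _ => none, by
      simp only [Finset.mem_filter, Finset.mem_univ, true_and]
      constructor <;> simp⟩
  replace hc := (Finset.mem_filter.1 hc).2
  replace hmax := fun c' (h' : G.IsPartialEdgeColoring c') =>
    hmax c' (Finset.mem_filter.2 ⟨Finset.mem_univ _, h'⟩)
  have hsome : ∀ e : G.edgeSet, ∃ a, c e = some a := by
    rintro ⟨e, he⟩
    induction e with
    | _ u v => exact Option.ne_none_iff_exists'.1 (hc.ne_none_of_maximal hmax hK he)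
  choose f hf using hsome
  refine ⟨f, fun e e' hne hx heq => hne ?_⟩
  obtain ⟨x, hxe, hxe'⟩ := hx
  obtain ⟨y, hy⟩ := Sym2.mem_iff_exists.1 hxe
  obtain ⟨z, hz⟩ := Sym2.mem_iff_exists.1 hxe'
  have h1 := hf e
  have h2 := hf e'
  rw [hy] at h1
  rw [hz, ← heq] at h2
  exact Subtype.ext (by rw [hy, hz, hc.proper h1 h2])

end SimpleGraph

/-- For a simple graph `G` (all multiplicities 1),
`χ'(G) ≤ max_{uv ∈ E} ⌈max{d(u)+(d(v)-1)/2, d(v)+(d(u)-1)/2, (d(u)+d(v)+t(uv)-1)/2}⌉`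
(ceilings computed in `ℕ` via `(·+1)/2`). -/
theorem simple_graph_chromatic_index_bound {V : Type} [Fintype V] (G : SimpleGraph V) :
    ∃ c : G.edgeSet → Fin
      ((Finset.univ.filter fun p : V × V => G.Adj p.1 p.2).sup fun p =>
        max (G.degree p.1 + G.degree p.2 / 2)
          (max (G.degree p.2 + G.degree p.1 / 2)
            ((G.degree p.1 + G.degree p.2 + simpleT G p.1 p.2) / 2))),
      ∀ e f : G.edgeSet, e ≠ f →
        (∃ x : V, x ∈ (e : Sym2 V) ∧ x ∈ (f : Sym2 V)) → c e ≠ c f := by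
  refine G.exists_edgeColoring_of_degree_add_half_le fun x y hxy => ?_
  exact (le_max_left _ _).trans (Finset.le_sup (f := fun p : V × V =>
    max (G.degree p.1 + G.degree p.2 / 2)
      (max (G.degree p.2 + G.degree p.1 / 2)
        ((G.degree p.1 + G.degree p.2 + simpleT G p.1 p.2) / 2)))
    (Finset.mem_filter.2 ⟨Finset.mem_univ (x, y), hxy⟩))
end

section
/- For any graph G, the fractional chromatic number satisfies χ_f(G) ≤ max over vertices v of (d(v) + 1 + ω(v))/2. -/
open scoped Classical

/-- `ω(v)`: size of the largest clique containing `v`. -/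
noncomputable def omegaAt {α : Type} [Fintype α] (H : SimpleGraph α) (v : α) : ℕ :=
  ((Finset.univ : Finset (Finset α)).filter fun s : Finset α =>
    H.IsClique (↑s : Set α) ∧ v ∈ s).sup Finset.card

namespace SimpleGraph

variable {V : Type}

theorem isIndepSet_insert_of_forall_not_adj {G : SimpleGraph V} {S : Finset V} {v : V}
    (hS : G.IsIndepSet (S : Set V)) (h : ∀ u ∈ S, ¬ G.Adj v u) :
    G.IsIndepSet ((insert v S : Finset V) : Set V) := by
  intro a ha b hb hab
  simp only [Finset.coe_insert, Set.mem_insert_iff, Finset.mem_coe] at ha hb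
  rcases ha with rfl | ha <;> rcases hb with rfl | hb
  · exact absurd rfl hab
  · exact h b hb
  · exact fun h' => h a ha h'.symm
  · exact hS ha hb hab

variable [Fintype V]

/-- The stable sets of maximum size among those contained in `U`. -/
noncomputable def maxStableIn (G : SimpleGraph V) (U : Finset V) : Finset (Finset V) :=
  Finset.univ.filter fun S => S ⊆ U ∧ G.IsIndepSet (S : Set V) ∧
    ∀ T : Finset V, T ⊆ U → G.IsIndepSet (T : Set V) → T.card ≤ S.card

theorem mem_maxStableIn {G : SimpleGraph V} {U S : Finset V} :
    S ∈ G.maxStableIn U ↔ S ⊆ U ∧ G.IsIndepSet (S : Set V) ∧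
      ∀ T : Finset V, T ⊆ U → G.IsIndepSet (T : Set V) → T.card ≤ S.card := by
  simp [maxStableIn]

theorem maxStableIn_nonempty (G : SimpleGraph V) (U : Finset V) :
    (G.maxStableIn U).Nonempty := by
  obtain ⟨S, hS, hmax⟩ := Finset.exists_max_image
    (Finset.univ.filter fun S : Finset V => S ⊆ U ∧ G.IsIndepSet (S : Set V)) Finset.card
    ⟨∅, by simp [IsIndepSet]⟩
  simp only [Finset.mem_filter, Finset.mem_univ, true_and] at hS hmax
  exact ⟨S, mem_maxStableIn.2 ⟨hS.1, hS.2, fun T hT hT' => hmax T ⟨hT, hT'⟩⟩⟩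

theorem card_le_omegaAt {G : SimpleGraph V} {v : V} {K : Finset V}
    (hK : G.IsClique (K : Set V)) (hv : v ∈ K) : K.card ≤ omegaAt G v := by
  unfold omegaAt
  exact Finset.le_sup (f := Finset.card) (by simp [hK, hv])

/-- The vertices which extend `Q \ {v}` to another maximum stable set and lie in the closed
neighbourhood of `v` form a clique. -/
theorem card_exchange_le_omegaAt {G : SimpleGraph V} {U Q : Finset V} {v : V}
    (hQ : Q ∈ G.maxStableIn U) (hv : v ∈ Q) :
    ((insert v (G.neighborFinset v)).filter fun u =>
      insert u (Q.erase v) ∈ G.maxStableIn U).card ≤ omegaAt G v := by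
  obtain ⟨hQU, hQi, hQm⟩ := mem_maxStableIn.1 hQ
  have hnot : ∀ u, u = v ∨ G.Adj v u → u ∉ Q.erase v := by
    intro u hu hmem
    obtain ⟨hne, huQ⟩ := Finset.mem_erase.1 hmem
    rcases hu with rfl | hu
    · exact hne rfl
    · exact hQi (Finset.mem_coe.2 hv) (Finset.mem_coe.2 huQ) (Ne.symm hne) hu
  apply card_le_omegaAt
  · intro a ha b hb hab
    simp only [Finset.coe_filter, Set.mem_ofPred_eq, Finset.mem_insert, mem_neighborFinset] at ha hb
    by_contra hadj
    obtain ⟨haU, hai, -⟩ := mem_maxStableIn.1 ha.2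
    obtain ⟨hbU, hbi, -⟩ := mem_maxStableIn.1 hb.2
    have hindep : G.IsIndepSet ((insert a (insert b (Q.erase v)) : Finset V) : Set V) := by
      refine isIndepSet_insert_of_forall_not_adj hbi fun u hu => ?_
      rcases Finset.mem_insert.1 hu with rfl | hu
      · exact hadj
      · refine hai (by simp) (by simp [Finset.mem_erase.1 hu]) ?_
        rintro rfl
        exact hnot _ ha.1 hu
    have hle := hQm _ (Finset.insert_subset (haU (by simp)) hbU) hindep
    have h1 := hnot a ha.1
    have h2 := hnot b hb.1
    rw [Finset.card_insert_of_notMem (by simp only [Finset.mem_insert]; tauto),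
      Finset.card_insert_of_notMem h2, Finset.card_erase_of_mem hv] at hle
    omega
  · simp [Finset.insert_erase hv, hQ]

/-- The maximum stable sets meeting the closed neighbourhood of `v` in one vertex number at most
`ω(v)` times those which contain `v`. -/
theorem card_filter_inter_eq_one_le {G : SimpleGraph V} {U : Finset V} {v : V} (hv : v ∈ U) :
    ((G.maxStableIn U).filter fun S => (insert v (G.neighborFinset v) ∩ S).card = 1).card ≤
      omegaAt G v * ((G.maxStableIn U).filter fun S => v ∈ S).card := by
  refine Finset.card_le_mul_card_image_of_maps_to
    (f := fun S => insert v (S \ insert v (G.neighborFinset v))) ?_ _ ?_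
  · intro S hS
    obtain ⟨hS, h1⟩ := Finset.mem_filter.1 hS
    obtain ⟨hSU, hSi, hSm⟩ := mem_maxStableIn.1 hS
    have hcard : (insert v (S \ insert v (G.neighborFinset v))).card = S.card := by
      rw [Finset.card_insert_of_notMem (by simp)]
      have := Finset.card_sdiff_add_card_inter S (insert v (G.neighborFinset v))
      rw [Finset.inter_comm, h1] at this
      exact this
    refine Finset.mem_filter.2 ⟨mem_maxStableIn.2 ⟨?_, ?_, ?_⟩, by simp⟩
    · exact Finset.insert_subset hv (Finset.sdiff_subset.trans hSU)
    · refine isIndepSet_insert_of_forall_not_adj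
        (hSi.mono (Finset.coe_subset.2 Finset.sdiff_subset)) fun u hu => ?_
      simp only [Finset.mem_sdiff, Finset.mem_insert, mem_neighborFinset, not_or] at hu
      exact hu.2.2
    · intro T hT hTi
      rw [hcard]
      exact hSm T hT hTi
  · intro Q hQ
    obtain ⟨hQ, hvQ⟩ := Finset.mem_filter.1 hQ
    refine le_trans ?_ (card_exchange_le_omegaAt hQ hvQ)
    refine le_trans (Finset.card_le_card ?_)
      (Finset.card_image_le (f := fun u => insert u (Q.erase v)))
    intro S hS
    obtain ⟨hS, hSQ⟩ := Finset.mem_filter.1 hS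
    obtain ⟨hS, h1⟩ := Finset.mem_filter.1 hS
    obtain ⟨u, hu⟩ := Finset.card_eq_one.1 h1
    have huS : insert u (Q.erase v) = S := by
      rw [← hSQ, Finset.erase_insert (by simp), Finset.insert_eq, ← hu, Finset.inter_comm,
        Finset.union_comm, Finset.sdiff_union_inter]
    have hmem : u ∈ insert v (G.neighborFinset v) ∩ S := by simp [hu]
    refine Finset.mem_image.2 ⟨u, Finset.mem_filter.2 ⟨(Finset.mem_inter.1 hmem).1, ?_⟩, huS⟩
    rwa [huS]

theorem two_mul_card_maxStableIn_le {G : SimpleGraph V} {U : Finset V} {v : V} (hv : v ∈ U) :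
    2 * (G.maxStableIn U).card ≤
      ∑ u ∈ insert v (G.neighborFinset v), ((G.maxStableIn U).filter fun S => u ∈ S).card +
        omegaAt G v * ((G.maxStableIn U).filter fun S => v ∈ S).card := by
  refine le_trans ?_ (Nat.add_le_add_left (card_filter_inter_eq_one_le hv) _)
  have hswap : ∑ u ∈ insert v (G.neighborFinset v),
      ((G.maxStableIn U).filter fun S => u ∈ S).card =
      ∑ S ∈ G.maxStableIn U, (insert v (G.neighborFinset v) ∩ S).card := by
    simp_rw [← Finset.filter_mem_eq_inter]
    exact Finset.sum_card_bipartiteAbove_eq_sum_card_bipartiteBelow (fun u S => u ∈ S)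
  rw [hswap, Finset.card_filter, ← Finset.sum_add_distrib, mul_comm, ← smul_eq_mul]
  refine Finset.card_nsmul_le_sum _ _ _ fun S hS => ?_
  obtain ⟨hSU, hSi, hSm⟩ := mem_maxStableIn.1 hS
  have hpos : 0 < (insert v (G.neighborFinset v) ∩ S).card := by
    rw [Finset.card_pos, Finset.nonempty_iff_ne_empty]
    intro hempty
    have hdisj : ∀ u ∈ S, u ≠ v ∧ ¬ G.Adj v u := by
      intro u hu
      have : u ∉ insert v (G.neighborFinset v) ∩ S := by simp [hempty]
      simpa [hu] using this
    have := hSm _ (Finset.insert_subset hv hSU)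
      (isIndepSet_insert_of_forall_not_adj hSi fun u hu => (hdisj u hu).2)
    rw [Finset.card_insert_of_notMem fun h => (hdisj v h).1 rfl] at this
    omega
  split_ifs <;> omega

/-- Normalized version of `two_mul_card_maxStableIn_le`: the uniform distribution on the maximum
stable sets of `U`. -/
theorem exists_stable_distribution (G : SimpleGraph V) {U : Finset V} (hU : U.Nonempty) :
    ∃ w : Finset V → ℚ, (∀ s, 0 ≤ w s) ∧ (∀ s, w s ≠ 0 → s ⊆ U ∧ G.IsIndepSet (s : Set V)) ∧
      ∑ s, w s = 1 ∧ (∃ v ∈ U, 0 < ∑ s with v ∈ s, w s) ∧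
      ∀ v ∈ U, 2 ≤ ∑ u ∈ insert v (G.neighborFinset v), ∑ s with u ∈ s, w s +
        omegaAt G v * ∑ s with v ∈ s, w s := by
  set M := G.maxStableIn U with hM
  have hpos : (0 : ℚ) < M.card := by exact_mod_cast (G.maxStableIn_nonempty U).card_pos
  have hsum : ∀ u, ∑ s with u ∈ s, (if s ∈ M then (M.card : ℚ)⁻¹ else 0) =
      (M.filter fun S => u ∈ S).card * (M.card : ℚ)⁻¹ := by
    intro u
    rw [← Finset.sum_filter, Finset.sum_const, nsmul_eq_mul, Finset.filter_filter]
    congr 3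
    ext s
    simp [and_comm]
  have hkey : ∀ v ∈ U, (2 : ℚ) ≤ ∑ u ∈ insert v (G.neighborFinset v),
      ∑ s with u ∈ s, (if s ∈ M then (M.card : ℚ)⁻¹ else 0) +
        omegaAt G v * ∑ s with v ∈ s, (if s ∈ M then (M.card : ℚ)⁻¹ else 0) := by
    intro v hv
    have h : (2 : ℚ) * M.card ≤ ∑ u ∈ insert v (G.neighborFinset v),
        ((M.filter fun S => u ∈ S).card : ℚ) +
          omegaAt G v * (M.filter fun S => v ∈ S).card := by
      exact_mod_cast two_mul_card_maxStableIn_le hv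
    simp_rw [hsum]
    rw [← Finset.sum_mul, ← mul_assoc, ← add_mul, ← div_eq_mul_inv, le_div_iff₀ hpos]
    exact h
  refine ⟨fun s => if s ∈ M then (M.card : ℚ)⁻¹ else 0, ?_, ?_, ?_, ?_, hkey⟩
  · intro s
    positivity
  · intro s hs
    have hs : s ∈ M := by
      by_contra h
      simp [h] at hs
    exact ⟨(mem_maxStableIn.1 hs).1, (mem_maxStableIn.1 hs).2.1⟩
  · simp [hpos.ne']
  · obtain ⟨v, hv⟩ := hU
    obtain ⟨S, hS⟩ := G.maxStableIn_nonempty U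
    obtain ⟨hSU, -, hSm⟩ := mem_maxStableIn.1 hS
    have hcard : 1 ≤ S.card := by
      simpa using hSm {v} (by simpa using hv) (by simp [IsIndepSet])
    obtain ⟨u, hu⟩ := Finset.card_pos.1 hcard
    refine ⟨u, hSU hu, ?_⟩
    rw [hsum]
    have : 0 < (M.filter fun S => u ∈ S).card :=
      Finset.card_pos.2 ⟨S, Finset.mem_filter.2 ⟨hS, hu⟩⟩
    positivity

/-- Fractional colouring with vertex demands `r`, by greedily spending uniform weight on the
maximum stable sets of the vertices with unmet demand. -/
theorem exists_fractional_coloring_of_demand (G : SimpleGraph V) (r : V → ℚ)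
    (hr : ∀ v, 0 ≤ r v) (hne : (Finset.univ.filter fun v => 0 < r v).Nonempty) :
    ∃ w : Finset V → ℚ, (∀ s, 0 ≤ w s) ∧ (∀ s, w s ≠ 0 → G.IsIndepSet (s : Set V)) ∧
      (∀ v, ∑ s with v ∈ s, w s = r v) ∧
      ∃ v, 0 < r v ∧
        2 * ∑ s, w s ≤ ∑ u ∈ insert v (G.neighborFinset v), r u + omegaAt G v * r v := by
  induction hn : (Finset.univ.filter fun v => 0 < r v).card using Nat.strong_induction_on
    generalizing r with
  | _ n ih =>
  obtain ⟨q, hq0, hqi, hq1, ⟨v₀, hv₀U, hv₀⟩, hqkey⟩ := G.exists_stable_distribution hne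
  set p : V → ℚ := fun v => ∑ s with v ∈ s, q s with hp
  have hp0 : ∀ v, 0 ≤ p v := fun v => Finset.sum_nonneg fun s _ => hq0 s
  have hpU : ∀ v, 0 < p v → 0 < r v := by
    intro v hv
    obtain ⟨s, hs, hs'⟩ := Finset.exists_ne_zero_of_sum_ne_zero hv.ne'
    simpa using (hqi s hs').1 (Finset.mem_filter.1 hs).2
  obtain ⟨x, hx, hxmin⟩ := Finset.exists_min_image
    (Finset.univ.filter fun v => 0 < p v) (fun v => r v / p v) ⟨v₀, by simpa using hv₀⟩
  simp only [Finset.mem_filter, Finset.mem_univ, true_and] at hx hxmin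
  set t := r x / p x with ht
  have ht0 : 0 ≤ t := div_nonneg (hr x) hx.le
  have hr' : ∀ v, 0 ≤ r v - t * p v := by
    intro v
    rcases (hp0 v).eq_or_lt with h | h
    · simpa [← h] using hr v
    · have := (le_div_iff₀ h).1 (hxmin v h)
      linarith
  have hsub : ∀ v, 0 < r v - t * p v → 0 < r v := fun v hv => by
    have := mul_nonneg ht0 (hp0 v)
    linarith
  have hspend : ∀ w : Finset V → ℚ, (∀ s, 0 ≤ w s) →
      (∀ s, w s ≠ 0 → G.IsIndepSet (s : Set V)) →
      (∀ v, ∑ s with v ∈ s, w s = r v - t * p v) →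
      (∃ v, 0 < r v ∧ 2 * ∑ s, w s ≤ ∑ u ∈ insert v (G.neighborFinset v), (r u - t * p u) +
        omegaAt G v * (r v - t * p v)) →
      ∃ w : Finset V → ℚ, (∀ s, 0 ≤ w s) ∧ (∀ s, w s ≠ 0 → G.IsIndepSet (s : Set V)) ∧
      (∀ v, ∑ s with v ∈ s, w s = r v) ∧
      ∃ v, 0 < r v ∧
        2 * ∑ s, w s ≤ ∑ u ∈ insert v (G.neighborFinset v), r u + omegaAt G v * r v := by
    rintro w hw0 hwi hwr ⟨v, hv, hb⟩
    refine ⟨fun s => w s + t * q s, fun s => add_nonneg (hw0 s) (mul_nonneg ht0 (hq0 s)),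
      ?_, ?_, v, hv, ?_⟩
    · intro s hs
      by_cases h : w s = 0
      · exact (hqi s fun h' => hs (by simp [h, h'])).2
      · exact hwi s h
    · intro u
      rw [Finset.sum_add_distrib, hwr, ← Finset.mul_sum]
      exact sub_add_cancel _ _
    · rw [Finset.sum_add_distrib, ← Finset.mul_sum, hq1]
      rw [Finset.sum_sub_distrib, ← Finset.mul_sum] at hb
      have := mul_le_mul_of_nonneg_left (hqkey v (by simpa using hv)) ht0
      linarith
  by_cases hne' : (Finset.univ.filter fun v => 0 < r v - t * p v).Nonempty
  · obtain ⟨w, hw0, hwi, hwr, v, hv, hb⟩ := ih _ (by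
      rw [← hn]
      refine Finset.card_lt_card (Finset.ssubset_iff_of_subset ?_ |>.2 ⟨x, ?_, ?_⟩)
      · intro v hv
        simpa using hsub v (by simpa using hv)
      · simpa using hpU x hx
      · simp [ht, hx.ne']) (fun v => r v - t * p v) hr' hne' rfl
    exact hspend w hw0 hwi hwr ⟨v, hsub v hv, hb⟩
  · have hzero : ∀ v, r v - t * p v = 0 := by
      intro v
      refine le_antisymm (not_lt.1 fun h => hne' ⟨v, by simpa using h⟩) (hr' v)
    refine hspend 0 (by simp) (by simp) (by simp [hzero]) ⟨x, hpU x hx, ?_⟩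
    simp [hzero]

end SimpleGraph

/-- **McDiarmid.** For any graph `G`,
`χ_f(G) ≤ max_v (d(v) + 1 + ω(v))/2`: there is a fractional colouring, i.e. a
nonnegative weighting of the stable sets covering every vertex with total weight at
least 1, whose total weight is at most `max_v (d(v) + 1 + ω(v))/2`. -/
theorem fractional_chromatic_local_bound {V : Type} [Fintype V] [Nonempty V]
    (G : SimpleGraph V) :
    ∃ w : Finset V → ℚ,
      (∀ s : Finset V, 0 ≤ w s) ∧
      (∀ s : Finset V, w s ≠ 0 → Gᶜ.IsClique (↑s : Set V)) ∧
      (∀ v : V, 1 ≤ Finset.sum (Finset.univ.filter fun s : Finset V => v ∈ s) w) ∧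
      Finset.sum Finset.univ w ≤
        Finset.univ.sup' Finset.univ_nonempty
          (fun v : V => ((G.degree v + 1 + omegaAt G v : ℕ) : ℚ) / 2) := by
  obtain ⟨w, hw0, hwi, hwr, v, -, hb⟩ := G.exists_fractional_coloring_of_demand (fun _ => 1)
    (fun _ => zero_le_one) (by simp)
  refine ⟨w, hw0, fun s hs => (SimpleGraph.isClique_compl G).2 (hwi s hs), fun v => (hwr v).ge,
    le_trans ?_ (Finset.le_sup' (fun v : V => ((G.degree v + 1 + omegaAt G v : ℕ) : ℚ) / 2)
      (Finset.mem_univ v))⟩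
  rw [Finset.sum_const, Finset.card_insert_of_notMem (by simp),
    SimpleGraph.card_neighborFinset_eq_degree] at hb
  push_cast
  simp only [nsmul_eq_mul, mul_one] at hb
  push_cast at hb
  linarith
end
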